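/- Let 1 ≤ p ≤ n−1 and 1 ≤ l ≤ n. Then for all but finitely many r ∈ S the commutator [Σ_{k=1}^{m} ( :psi_k^p(−r) psibar_k^{p+1}(r): − :psi_k^{n−p}(−r) psibar_k^{n+1−p}(r): ), B_l] vanishes, and the (finite) sum satisfies Σ_{r∈S} [Σ_{k=1}^{m} ( :psi_k^p(−r) psibar_k^{p+1}(r): − :psi_k^{n−p}(−r) psibar_k^{n+1−p}(r): ), B_l] = 0 in W_N(S). -/

import Mathlib

noncomputable section

/-- Context for the enlarged Weyl algebra `W_N(S)` with `N = m·n` and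
`S = ℤ` (encoded by `sig = 0`) or `S = ℤ + 1/2` (encoded by `sig = 1`).
An element `r ∈ S` is encoded by the unique integer `k` with `r = k + sig/2`,
so that `ε := 1/2 - sig/2` and e.g. `r > 0 ↔ 0 < 2k + sig`.
The data also fixes a generic `q ∈ ℂˣ` together with a square root `sq` of `q`. -/
structure WCtx where
  m : ℕ
  n : ℕ
  hm : 0 < m
  hn : 0 < n
  sig : ℤ
  hsig : sig = 0 ∨ sig = 1
  q : ℂ
  sq : ℂ
  hsq : sq ^ 2 = q
  hq0 : q ≠ 0
  hqu : ∀ k : ℕ, k ≠ 0 → q ^ k ≠ 1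

namespace WCtx

variable (C : WCtx)

/-- `N = m n`. -/
def NN : ℕ := C.m * C.n

/-- Names of the generators of `W_N(S)`: `Sum.inl i` is `ψ_{i+1}` and
`Sum.inr i` is `ψ̄_{i+1}`; the integer `k` encodes the index `r = k + sig/2 ∈ S`. -/
abbrev Gen : Type := (Fin C.NN ⊕ Fin C.NN) × ℤ

/-- The defining relations of the enlarged Weyl algebra `W_N(S)`:
any two `ψ`'s commute, any two `ψ̄`'s commute, and
`ψ̄_i(k)ψ_j(r) − ψ_j(r)ψ̄_i(k) = δ_{i,j} δ_{k+r,0}`. -/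
inductive rel : FreeAlgebra ℂ C.Gen → FreeAlgebra ℂ C.Gen → Prop
  | comm_psi (i j : Fin C.NN) (k l : ℤ) :
      rel (FreeAlgebra.ι ℂ ((Sum.inl i, k) : C.Gen) * FreeAlgebra.ι ℂ ((Sum.inl j, l) : C.Gen))
          (FreeAlgebra.ι ℂ ((Sum.inl j, l) : C.Gen) * FreeAlgebra.ι ℂ ((Sum.inl i, k) : C.Gen))
  | comm_psibar (i j : Fin C.NN) (k l : ℤ) :
      rel (FreeAlgebra.ι ℂ ((Sum.inr i, k) : C.Gen) * FreeAlgebra.ι ℂ ((Sum.inr j, l) : C.Gen))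
          (FreeAlgebra.ι ℂ ((Sum.inr j, l) : C.Gen) * FreeAlgebra.ι ℂ ((Sum.inr i, k) : C.Gen))
  | mixed (i j : Fin C.NN) (k l : ℤ) :
      rel (FreeAlgebra.ι ℂ ((Sum.inr i, k) : C.Gen) * FreeAlgebra.ι ℂ ((Sum.inl j, l) : C.Gen))
          (FreeAlgebra.ι ℂ ((Sum.inl j, l) : C.Gen) * FreeAlgebra.ι ℂ ((Sum.inr i, k) : C.Gen)
            + (if i = j ∧ k + l + C.sig = 0 then 1 else 0))

/-- The enlarged Weyl algebra `W_N(S)`. -/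
def W : Type := RingQuot C.rel

instance : Ring C.W := inferInstanceAs (Ring (RingQuot C.rel))
instance : Algebra ℂ C.W := inferInstanceAs (Algebra ℂ (RingQuot C.rel))

/-- `ψ` with `0`-indexed flat subscript. -/
def psi0 (i : Fin C.NN) (k : ℤ) : C.W :=
  RingQuot.mkAlgHom ℂ C.rel (FreeAlgebra.ι ℂ ((Sum.inl i, k) : C.Gen))

/-- `ψ̄` with `0`-indexed flat subscript. -/
def psibar0 (i : Fin C.NN) (k : ℤ) : C.W :=
  RingQuot.mkAlgHom ℂ C.rel (FreeAlgebra.ι ℂ ((Sum.inr i, k) : C.Gen))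

/-- `ψ_i(r)` with `1`-indexed flat subscript `i ∈ {1,…,N}` (junk value `0` outside). -/
def psiF (i : ℕ) (k : ℤ) : C.W :=
  if h : 1 ≤ i ∧ i ≤ C.NN then C.psi0 ⟨i - 1, by omega⟩ k else 0

/-- `ψ̄_i(r)` with `1`-indexed flat subscript `i ∈ {1,…,N}` (junk value `0` outside). -/
def psibarF (i : ℕ) (k : ℤ) : C.W :=
  if h : 1 ≤ i ∧ i ≤ C.NN then C.psibar0 ⟨i - 1, by omega⟩ k else 0

/-- `ψ_i^c(r) = ψ_{i+(c-1)m}(r)`, subscript `i ∈ {1,…,m}`, superscript `c ∈ {1,…,n}`. -/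
def psiS (i c : ℕ) (k : ℤ) : C.W := C.psiF (i + (c - 1) * C.m) k

/-- `ψ̄_i^c(r) = ψ̄_{i+(c-1)m}(r)`. -/
def psibarS (i c : ℕ) (k : ℤ) : C.W := C.psibarF (i + (c - 1) * C.m) k

/-- The left ideal of `W_N(S)` generated by all `ψ_i(r), ψ̄_i(r)` with `r > 0`,
together with all `ψ̄_i(0)` when `S = ℤ`. -/
def vacIdeal : Submodule C.W C.W :=
  Submodule.span C.W
    {w : C.W |
      (∃ (i : Fin C.NN) (k : ℤ), 0 < 2 * k + C.sig ∧ (w = C.psi0 i k ∨ w = C.psibar0 i k)) ∨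
        (C.sig = 0 ∧ ∃ i : Fin C.NN, w = C.psibar0 i 0)}

/-- The Fock module `F_N(S) = W_N(S)/I`. -/
def F : Type := C.W ⧸ C.vacIdeal

instance : AddCommGroup C.F := inferInstanceAs (AddCommGroup (C.W ⧸ C.vacIdeal))
instance : Module C.W C.F := inferInstanceAs (Module C.W (C.W ⧸ C.vacIdeal))
instance : Module ℂ C.F := inferInstanceAs (Module ℂ (C.W ⧸ C.vacIdeal))

/-- The vacuum vector `|0⟩ ∈ F_N(S)`. -/
def vac : C.F := Submodule.Quotient.mk (1 : C.W)

/-- Normal ordering `:u(k) v(l):` where `l` encodes the `S`-index of the second factor. -/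
def nord (u : C.W) (l : ℤ) (v : C.W) : C.W :=
  if 0 < 2 * l + C.sig then u * v
  else if 2 * l + C.sig = 0 then (2 : ℂ)⁻¹ • (u * v + v * u)
  else v * u

/-- `ε = 0` if `S = ℤ + 1/2`, `ε = 1/2` if `S = ℤ`, as a complex number. -/
def eps : ℂ := (1 - (C.sig : ℂ)) / 2

/-- `ω_S(b)`. -/
def om (b : ℤ) : ℂ :=
  if b = 0 then 0
  else if C.sig = 0 then (2 : ℂ)⁻¹ * ((C.q ^ b + 1) / (C.q ^ b - 1))
  else C.sq ^ b / (C.q ^ b - 1)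

/-- `q^{-b r}` for `r = k + sig/2 ∈ S`. -/
def qp (b k : ℤ) : ℂ := C.sq ^ (-(b * (2 * k + C.sig)))

/-- `q^{b r}` for `r = k + sig/2 ∈ S`. -/
def qpp (b k : ℤ) : ℂ := C.sq ^ (b * (2 * k + C.sig))

/-- `φ^c_{t + sig/2}`; here `t ∈ ℤ` encodes the half-integer index `t + sig/2 = t + 1/2 - ε`.
Writing `t = (k + sig)m - i` with `1 ≤ i ≤ m`, `k ∈ ℤ`, this is `ψ_i^c(k + sig/2)`. -/
def PhiW (c : ℕ) (t : ℤ) : C.W :=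
  C.psiF ((((-t - 1).emod C.m).toNat + 1) + (c - 1) * C.m)
    ((t + (-t - 1).emod C.m + 1) / C.m - C.sig)

/-- `φ̄^c_{t + sig/2}`; writing `t = k·m + i - 1` with `1 ≤ i ≤ m`, `k ∈ ℤ`,
this is `ψ̄_i^c(k + sig/2)`. -/
def PhibarW (c : ℕ) (t : ℤ) : C.W :=
  C.psibarF (((t.emod C.m).toNat + 1) + (c - 1) * C.m) ((t - t.emod C.m) / C.m)

/-- Determinant of a square matrix with (pairwise commuting) entries in `W_N(S)`. -/
def ncdet {l : ℕ} (M : Fin l → Fin l → C.W) : C.W :=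
  ∑ p : Equiv.Perm (Fin l),
    (((Equiv.Perm.sign p : ℤˣ) : ℤ)) • ((List.finRange l).map fun t => M (p t) t).prod

/-- The element `A_l ∈ W_N(S)`, `1 ≤ l ≤ n`. -/
def Adet (l : ℕ) : C.W :=
  C.ncdet fun k t : Fin l => C.PhiW ((k : ℕ) + 1) (-(((t : ℕ) : ℤ) + 1))

/-- The element `Ā_l ∈ W_N(S)`, `1 ≤ l ≤ n`. -/
def Abar (l : ℕ) : C.W :=
  C.ncdet fun s t : Fin (C.n - l + 1) => C.PhibarW (C.n - (s : ℕ)) (-(((t : ℕ) : ℤ) + 1))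

/-- `α(r,a,i) = (a - r + 1/2 - ε)m - i + 1 = (a-k)m - i + 1` for `r = k + sig/2`. -/
def alphaV (k a : ℤ) (i : ℕ) : ℤ := (a - k) * C.m - (i : ℤ) + 1

/-- `β(r,a,j) = (r + a - 1/2 + ε)m + j = (k+a)m + j` for `r = k + sig/2`. -/
def betaV (k a : ℤ) (j : ℕ) : ℤ := (k + a) * C.m + (j : ℤ)

/-- `Σ_{c=1}^{n} ψ_i^c(a-r) ψ̄_j^c(r)`, where `k` encodes `r`. -/
def Esum (i j : ℕ) (a k : ℤ) : C.W :=
  ∑ c : Fin C.n, C.psiS i ((c : ℕ) + 1) (a - k - C.sig) * C.psibarS j ((c : ℕ) + 1) k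

/-- `A_l^{i,j,r}`: `A_l` with the `β(r,0,j)`-th column replaced by
`(φ^1_{α(r,a,i)-1/2-ε}, …, φ^l_{α(r,a,i)-1/2-ε})ᵗ`. -/
def Amod (l : ℕ) (i j : ℕ) (a k : ℤ) : C.W :=
  C.ncdet fun r t : Fin l =>
    if (((t : ℕ) : ℤ) + 1) = C.betaV k 0 j then C.PhiW ((r : ℕ) + 1) (C.alphaV k a i - 1)
    else C.PhiW ((r : ℕ) + 1) (-(((t : ℕ) : ℤ) + 1))

/-- `Ā_l^{i,j,r}`: `Ā_l` with the `α(r,a,i)`-th column replaced by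
`(-φ̄^n_{β(r,0,j)-1/2-ε}, …, -φ̄^l_{β(r,0,j)-1/2-ε})ᵗ`. -/
def Abarmod (l : ℕ) (i j : ℕ) (a k : ℤ) : C.W :=
  C.ncdet fun s t : Fin (C.n - l + 1) =>
    if (((t : ℕ) : ℤ) + 1) = C.alphaV k a i then -C.PhibarW (C.n - (s : ℕ)) (C.betaV k 0 j - 1)
    else C.PhibarW (C.n - (s : ℕ)) (-(((t : ℕ) : ℤ) + 1))

/-- `l̄₁` for `l = l₁ m + l₂`, `1 ≤ l₂ ≤ m`. -/
def lb1 (l : ℕ) : ℕ :=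
  if (l - 1) / C.m % 2 = 0 then ((l - 1) / C.m / 2) * C.m + ((l - 1) % C.m + 1)
  else (((l - 1) / C.m + 1) / 2) * C.m

/-- `l̄₂ = l - l̄₁`. -/
def lb2 (l : ℕ) : ℕ := l - C.lb1 l

/-- The `(k,t)` entry of the matrix defining `B_l`. -/
def Bentry (l : ℕ) (k t : Fin l) : C.W :=
  if (t : ℕ) + 1 ≤ C.lb1 l then C.PhiW ((k : ℕ) + 1) (-(((t : ℕ) : ℤ) + 1))
  else C.PhibarW (C.n - (k : ℕ)) (-((((t : ℕ) : ℤ) + 1) - (C.lb1 l : ℤ)))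

/-- The element `B_l ∈ W_N(S)`, `1 ≤ l ≤ n`. -/
def Bdet (l : ℕ) : C.W := C.ncdet (C.Bentry l)

/-- The element `B̄_{n/2} ∈ W_N(S)` (`n` even): `B_{n/2}` with its `(n/2)`-th row replaced. -/
def Bbar : C.W :=
  C.ncdet fun k t : Fin (C.n / 2) =>
    if (k : ℕ) + 1 = C.n / 2 then
      (if (t : ℕ) + 1 ≤ C.lb1 (C.n / 2) then C.PhiW (C.n / 2 + 1) (-(((t : ℕ) : ℤ) + 1))
       else C.PhibarW (C.n / 2) (-((((t : ℕ) : ℤ) + 1) - (C.lb1 (C.n / 2) : ℤ))))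
    else C.Bentry (C.n / 2) k t

/-- `B_l` with its `pos`-th column replaced by the column `(col 1, …, col l)ᵗ`. -/
def Bcolrep (l : ℕ) (pos : ℤ) (col : ℕ → C.W) : C.W :=
  C.ncdet fun k t : Fin l =>
    if (((t : ℕ) : ℤ) + 1) = pos then col ((k : ℕ) + 1) else C.Bentry l k t

/-- The operator `T_{i,j}(a,b) = Σ_{r∈S} q^{-br} Σ_{c=1}^n :ψ_i^c(a-r) ψ̄_j^c(r):`. -/
def Top (i j : ℕ) (a b : ℤ) (x : C.F) : C.F :=
  ∑ᶠ k : ℤ, (C.qp b k • ∑ c : Fin C.n,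
    C.nord (C.psiS i ((c : ℕ) + 1) (a - k - C.sig)) k (C.psibarS j ((c : ℕ) + 1) k)) • x

/-- The operator `S_{i,j}(c,d) = Σ_{e=1}^n ψ_i^e(c) ψ̄_j^e(d)`. -/
def Sop (i j : ℕ) (c d : ℤ) (x : C.F) : C.F :=
  (∑ e : Fin C.n, C.psiS i ((e : ℕ) + 1) c * C.psibarS j ((e : ℕ) + 1) d) • x

/-- The operator `E_{p,p} = Σ_{c=1}^m Σ_{r∈S} :ψ_c^p(-r) ψ̄_c^p(r): − ε m`. -/
def Epp (p : ℕ) (x : C.F) : C.F :=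
  (∑ᶠ k : ℤ, (∑ c : Fin C.m,
      C.nord (C.psiS ((c : ℕ) + 1) p (-k - C.sig)) k (C.psibarS ((c : ℕ) + 1) p k)) • x)
    - (C.eps * (C.m : ℂ)) • x

/-- The operator `E_i(b) = Σ_{r∈S} q^{-br} Σ_{c=1}^n :ψ_i^c(-r) ψ̄_i^c(r): − n ω_S(b)`. -/
def Eib (i : ℕ) (b : ℤ) (x : C.F) : C.F :=
  (∑ᶠ k : ℤ, (C.qp b k • ∑ c : Fin C.n,
      C.nord (C.psiS i ((c : ℕ) + 1) (-k - C.sig)) k (C.psibarS i ((c : ℕ) + 1) k)) • x)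
    - ((C.n : ℂ) * C.om b) • x

/-- `Σ_{r ∈ J^S_{i,l}} q^{-br}`. -/
def Jsum (i l : ℕ) (b : ℤ) : ℂ :=
  ∑ᶠ k ∈ {k : ℤ | 1 ≤ k * (C.m : ℤ) + (i : ℤ) ∧ k * (C.m : ℤ) + (i : ℤ) ≤ (l : ℤ)}, C.qp b k

/-- `Σ_{r ∈ J̄^S_{i,l}} q^{-br}`. -/
def Jbarsum (i l : ℕ) (b : ℤ) : ℂ :=
  ∑ᶠ k ∈ {k : ℤ | 1 ≤ -(k * (C.m : ℤ)) - (i : ℤ) + 1 ∧ -(k * (C.m : ℤ)) - (i : ℤ) + 1 ≤ (l : ℤ)},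
    C.qp b k

/-- `Σ_{r ∈ J^S_{i,l}} q^{br}`. -/
def JsumP (i l : ℕ) (b : ℤ) : ℂ :=
  ∑ᶠ k ∈ {k : ℤ | 1 ≤ k * (C.m : ℤ) + (i : ℤ) ∧ k * (C.m : ℤ) + (i : ℤ) ≤ (l : ℤ)}, C.qpp b k

/-- `Σ_{c=1}^m ψ_c^p(-r) ψ̄_c^{p+1}(r)` (no normal ordering), `k` encoding `r ∈ S`. -/
def glRaise (p : ℕ) (k : ℤ) : C.W :=
  ∑ c : Fin C.m, C.psiS ((c : ℕ) + 1) p (-k - C.sig) * C.psibarS ((c : ℕ) + 1) (p + 1) k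

/-- The operator `Σ_{c=1}^m Σ_{r∈S} :ψ_c^p(-r) ψ̄_c^{p+1}(r):`. -/
def glRaiseOp (p : ℕ) (x : C.F) : C.F :=
  ∑ᶠ k : ℤ, (∑ c : Fin C.m,
    C.nord (C.psiS ((c : ℕ) + 1) p (-k - C.sig)) k (C.psibarS ((c : ℕ) + 1) (p + 1) k)) • x

end WCtx

section InnerDerivation

variable {A R : Type*} [CommRing A] [Ring R] (φ : A →+* R)

/-- The Leibniz rule for the inner derivation `x ↦ y * x - x * y` on a product of commuting
elements. -/
theorem commutator_map_prod {ι : Type*} [DecidableEq ι] (y : R) (f g : ι → A)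
    (h : ∀ i, y * φ (f i) - φ (f i) * y = φ (g i)) (s : Finset ι) :
    y * φ (∏ i ∈ s, f i) - φ (∏ i ∈ s, f i) * y
      = φ (∑ i ∈ s, (∏ j ∈ s.erase i, f j) * g i) := by
  induction s using Finset.induction_on with
  | empty => simp
  | insert a s ha ih =>
    have hsum : ∑ i ∈ s, (∏ j ∈ (insert a s).erase i, f j) * g i
        = f a * ∑ i ∈ s, (∏ j ∈ s.erase i, f j) * g i := by
      rw [Finset.mul_sum]
      refine Finset.sum_congr rfl fun i hi => ?_
      have hia : a ≠ i := fun h => ha (h ▸ hi)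
      rw [Finset.erase_insert_of_ne hia, Finset.prod_insert (by simp [ha]), mul_assoc]
    rw [Finset.prod_insert ha, Finset.sum_insert ha, Finset.erase_insert ha, hsum,
      mul_comm (∏ j ∈ s, f j) (g a), map_add, map_mul, map_mul, map_mul, ← ih, ← h a]
    noncomm_ring

/-- If an inner derivation replaces each row of a matrix with commuting entries by a combination
of the other rows, then it kills the determinant. -/
theorem commute_map_det {n : Type*} [Fintype n] [DecidableEq n] (M : Matrix n n A)
    (N : n → n → ℤ) (hN : ∀ i, N i i = 0) (y : R)
    (h : ∀ i t, y * φ (M i t) - φ (M i t) * y = ∑ j, (N i j : R) * φ (M j t)) :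
    Commute y (φ M.det) := by
  have hdet : ∀ B : Matrix n n A,
      B.det = ∑ σ : Equiv.Perm n, (Equiv.Perm.sign σ : ℤ) • ∏ i, B i (σ i) := fun B => by
    rw [← Matrix.det_transpose, Matrix.det_apply]
    rfl
  have hrow : ∀ i, (M.updateRow i (∑ j, (N i j : A) • M j)).det = 0 := fun i => by
    rw [Matrix.det_updateRow_sum]
    simp [hN]
  have hprod : ∀ σ : Equiv.Perm n, ∀ i, ∏ u, (M.updateRow i (∑ j, (N i j : A) • M j)) u (σ u)
      = (∏ u ∈ Finset.univ.erase i, M u (σ u)) * ∑ j, (N i j : A) * M j (σ i) := fun σ i => by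
    rw [← Finset.prod_erase_mul _ _ (Finset.mem_univ i)]
    congr 1
    · exact Finset.prod_congr rfl fun u hu => by
        rw [Matrix.updateRow_ne (Finset.ne_of_mem_erase hu)]
    · simp [Matrix.updateRow_self, Finset.sum_apply]
  have key : y * φ M.det - φ M.det * y
      = φ (∑ i, (M.updateRow i (∑ j, (N i j : A) • M j)).det) := by
    simp_rw [hdet, hprod]
    rw [Finset.sum_comm]
    simp_rw [← Finset.smul_sum]
    rw [map_sum, map_sum, Finset.mul_sum, Finset.sum_mul, ← Finset.sum_sub_distrib]
    refine Finset.sum_congr rfl fun σ _ => ?_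
    rw [map_zsmul, map_zsmul, mul_smul_comm, smul_mul_assoc, ← smul_sub,
      commutator_map_prod φ y (fun i => M i (σ i)) (fun i => ∑ j, (N i j : A) * M j (σ i))
        (fun i => by rw [h]; simp)]
  rw [Finset.sum_eq_zero fun i _ => hrow i, map_zero] at key
  exact sub_eq_zero.mp key

end InnerDerivation

namespace WCtx

variable (C : WCtx)

theorem ncdet_eq_map_det {A : Type*} [CommRing A] (φ : A →+* C.W) {l : ℕ}
    (M : Matrix (Fin l) (Fin l) A) : C.ncdet (fun i t => φ (M i t)) = φ M.det := by
  rw [Matrix.det_apply, map_sum, ncdet]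
  refine Finset.sum_congr rfl fun σ _ => ?_
  rw [Units.smul_def, map_zsmul, ← List.prod_ofFn, map_list_prod, List.map_ofFn, List.ofFn_eq_map]
  rfl

open scoped IsMulCommutative in
theorem commute_ncdet {l : ℕ} (M : Fin l → Fin l → C.W)
    (hM : ∀ i t j s, Commute (M i t) (M j s)) (N : Fin l → Fin l → ℤ) (hN : ∀ i, N i i = 0)
    (y : C.W) (h : ∀ i t, y * M i t - M i t * y = ∑ j, (N i j : C.W) * M j t) :
    Commute y (C.ncdet M) := by
  let s : Set C.W := Set.range fun x : Fin l × Fin l => M x.1 x.2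
  have : IsMulCommutative (Subring.closure s) := Subring.isMulCommutative_closure <| by
    rintro _ ⟨⟨i, t⟩, rfl⟩ _ ⟨⟨j, u⟩, rfl⟩
    exact hM i t j u
  let M' : Matrix (Fin l) (Fin l) (Subring.closure s) :=
    fun i t => ⟨M i t, Subring.subset_closure ⟨(i, t), rfl⟩⟩
  have hdet : C.ncdet M = (Subring.closure s).subtype M'.det :=
    C.ncdet_eq_map_det (Subring.closure s).subtype M'
  rw [hdet]
  exact commute_map_det _ M' N hN y h

/-- A family of inner derivations, each column of the matrix being moved by one member of the
family only, whose total effect is an off-diagonal row operation, sums to zero on the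
determinant. -/
theorem finite_and_finsum_commutator_ncdet {l : ℕ} (M : Fin l → Fin l → C.W)
    (hM : ∀ i t j s, Commute (M i t) (M j s)) (N : Fin l → Fin l → ℤ) (hN : ∀ i, N i i = 0)
    (X : ℤ → C.W) (κ : Fin l → ℤ)
    (h : ∀ k i t, X k * M i t - M i t * X k
      = if k = κ t then ∑ j, (N i j : C.W) * M j t else 0) :
    {k : ℤ | X k * C.ncdet M - C.ncdet M * X k ≠ 0}.Finite ∧
      ∑ᶠ k : ℤ, (X k * C.ncdet M - C.ncdet M * X k) = 0 := by
  let K : Finset ℤ := Finset.univ.image κ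
  have hsub : (fun k => X k * C.ncdet M - C.ncdet M * X k).support ⊆ K := fun k hk => by
    by_contra hkK
    refine hk (sub_eq_zero.mpr (C.commute_ncdet M hM 0 (fun _ => rfl) (X k) fun i t => ?_))
    have hne : k ≠ κ t := fun e => hkK (by simp [K, e])
    simp [h, hne]
  refine ⟨K.finite_toSet.subset hsub, ?_⟩
  rw [finsum_eq_sum_of_support_subset _ hsub, Finset.sum_sub_distrib, ← Finset.sum_mul,
    ← Finset.mul_sum, sub_eq_zero]
  refine C.commute_ncdet M hM N hN _ fun i t => ?_
  rw [Finset.sum_mul, Finset.mul_sum, ← Finset.sum_sub_distrib]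
  simp_rw [h]
  rw [Finset.sum_ite_eq', if_pos (by simp [K])]

theorem commute_psi0 (i j : Fin C.NN) (k l : ℤ) : Commute (C.psi0 i k) (C.psi0 j l) := by
  have := RingQuot.mkAlgHom_rel ℂ (rel.comm_psi (C := C) i j k l)
  rwa [map_mul, map_mul] at this

theorem commute_psibar0 (i j : Fin C.NN) (k l : ℤ) :
    Commute (C.psibar0 i k) (C.psibar0 j l) := by
  have := RingQuot.mkAlgHom_rel ℂ (rel.comm_psibar (C := C) i j k l)
  rwa [map_mul, map_mul] at this

theorem psibar0_mul_psi0 (i j : Fin C.NN) (k l : ℤ) :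
    C.psibar0 i k * C.psi0 j l
      = C.psi0 j l * C.psibar0 i k + if i = j ∧ k + l + C.sig = 0 then 1 else 0 := by
  have := RingQuot.mkAlgHom_rel ℂ (rel.mixed (C := C) i j k l)
  rw [map_mul, map_add, map_mul, apply_ite (RingQuot.mkAlgHom ℂ C.rel), map_one, map_zero] at this
  exact this

theorem commute_psiS (i j c d : ℕ) (k l : ℤ) : Commute (C.psiS i c k) (C.psiS j d l) := by
  unfold psiS psiF
  split_ifs <;> simp [commute_psi0]

theorem commute_psibarS (i j c d : ℕ) (k l : ℤ) :
    Commute (C.psibarS i c k) (C.psibarS j d l) := by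
  unfold psibarS psibarF
  split_ifs <;> simp [commute_psibar0]

theorem flat_index_bounds {i c : ℕ} (hi : 1 ≤ i ∧ i ≤ C.m) (hc : 1 ≤ c ∧ c ≤ C.n) :
    1 ≤ i + (c - 1) * C.m ∧ i + (c - 1) * C.m ≤ C.NN := by
  obtain ⟨c, rfl⟩ := Nat.exists_eq_add_of_le' hc.1
  have : (c + 1) * C.m ≤ C.n * C.m := Nat.mul_le_mul_right _ hc.2
  simp only [Nat.add_sub_cancel, NN]
  constructor <;> nlinarith

theorem flat_index_inj {i j c d : ℕ} (hi : 1 ≤ i ∧ i ≤ C.m) (hj : 1 ≤ j ∧ j ≤ C.m)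
    (hc : 1 ≤ c) (hd : 1 ≤ d) :
    i + (c - 1) * C.m = j + (d - 1) * C.m ↔ i = j ∧ c = d := by
  refine ⟨fun h => ?_, by rintro ⟨rfl, rfl⟩; rfl⟩
  obtain ⟨i, rfl⟩ := Nat.exists_eq_add_of_le' hi.1
  obtain ⟨j, rfl⟩ := Nat.exists_eq_add_of_le' hj.1
  have h' : i + (c - 1) * C.m = j + (d - 1) * C.m := by omega
  have hdiv := congrArg (· / C.m) h'
  simp only [Nat.add_mul_div_right _ _ C.hm, Nat.div_eq_of_lt hi.2, Nat.div_eq_of_lt hj.2] at hdiv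
  have hcd : c = d := by omega
  subst hcd
  exact ⟨by omega, rfl⟩

theorem psibarS_mul_psiS {i j c d : ℕ} (hi : 1 ≤ i ∧ i ≤ C.m) (hj : 1 ≤ j ∧ j ≤ C.m)
    (hc : 1 ≤ c ∧ c ≤ C.n) (hd : 1 ≤ d ∧ d ≤ C.n) (k l : ℤ) :
    C.psibarS i c k * C.psiS j d l = C.psiS j d l * C.psibarS i c k
      + if (i = j ∧ c = d) ∧ k + l + C.sig = 0 then 1 else 0 := by
  have h1 := C.flat_index_bounds hi hc
  have h2 := C.flat_index_bounds hj hd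
  have hiff := C.flat_index_inj hi hj hc.1 hd.1
  rw [psibarS, psibarF, dif_pos h1, psiS, psiF, dif_pos h2, psibar0_mul_psi0]
  congr 1
  refine if_congr (and_congr_left' ?_) rfl rfl
  rw [← hiff, Fin.mk.injEq]
  omega

theorem nord_of_commute {u v : C.W} (h : Commute u v) (l : ℤ) : C.nord u l v = u * v := by
  unfold nord
  split_ifs
  · rfl
  · rw [← h.eq, ← two_smul ℂ (u * v), smul_smul]
    norm_num
  · exact h.eq.symm

/-- `Σ_c ψ_c^a(-r) ψ̄_c^b(r)`, where `k` encodes `r`. -/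
def glUnit (a b : ℕ) (k : ℤ) : C.W :=
  ∑ c : Fin C.m, C.psiS ((c : ℕ) + 1) a (-k - C.sig) * C.psibarS ((c : ℕ) + 1) b k

theorem nord_psiS_psibarS {a b : ℕ} (hab : a ≠ b) (ha : 1 ≤ a ∧ a ≤ C.n) (hb : 1 ≤ b ∧ b ≤ C.n)
    (c : Fin C.m) (k l : ℤ) :
    C.nord (C.psiS ((c : ℕ) + 1) a l) k (C.psibarS ((c : ℕ) + 1) b k)
      = C.psiS ((c : ℕ) + 1) a l * C.psibarS ((c : ℕ) + 1) b k := by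
  have hc : 1 ≤ (c : ℕ) + 1 ∧ (c : ℕ) + 1 ≤ C.m := ⟨by omega, c.2⟩
  refine C.nord_of_commute ?_ k
  have := C.psibarS_mul_psiS hc hc hb ha k l
  rw [if_neg fun h => hab h.1.2.symm, add_zero] at this
  exact this.symm

theorem glUnit_commutator_psiS {a b i d : ℕ} (hb : 1 ≤ b ∧ b ≤ C.n)
    (hi : 1 ≤ i ∧ i ≤ C.m) (hd : 1 ≤ d ∧ d ≤ C.n) (k l : ℤ) :
    C.glUnit a b k * C.psiS i d l - C.psiS i d l * C.glUnit a b k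
      = if k = -l - C.sig then (if d = b then C.psiS i a l else 0) else 0 := by
  have hterm : ∀ c : Fin C.m,
      C.psiS ((c : ℕ) + 1) a (-k - C.sig) * C.psibarS ((c : ℕ) + 1) b k * C.psiS i d l
        - C.psiS i d l * (C.psiS ((c : ℕ) + 1) a (-k - C.sig) * C.psibarS ((c : ℕ) + 1) b k)
      = if c = ⟨i - 1, by omega⟩ then
          (if k = -l - C.sig then (if d = b then C.psiS i a l else 0) else 0) else 0 := fun c => by
    have hc : 1 ≤ (c : ℕ) + 1 ∧ (c : ℕ) + 1 ≤ C.m := ⟨by omega, c.2⟩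
    rw [mul_assoc, C.psibarS_mul_psiS hc hi hb hd, ← mul_assoc (C.psiS i d l),
      (C.commute_psiS i (c + 1) d a l (-k - C.sig)).eq, mul_add, mul_assoc, add_sub_cancel_left]
    by_cases h1 : (c : ℕ) + 1 = i
    · subst h1
      by_cases h2 : k = -l - C.sig
      · subst h2
        have h4 : -l - C.sig + l + C.sig = 0 := by omega
        by_cases h3 : d = b <;> simp [h3, h4, eq_comm (a := b)]
      · have : ¬ k + l + C.sig = 0 := by omega
        simp [h2, this]
    · have : ¬ c = ⟨i - 1, by omega⟩ := fun h => h1 (by rw [h]; simp; omega)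
      simp [h1, this]
  rw [glUnit, Finset.sum_mul, Finset.mul_sum, ← Finset.sum_sub_distrib]
  simp_rw [hterm]
  simp

theorem glUnit_commutator_psibarS {a b i d : ℕ} (ha : 1 ≤ a ∧ a ≤ C.n)
    (hi : 1 ≤ i ∧ i ≤ C.m) (hd : 1 ≤ d ∧ d ≤ C.n) (k l : ℤ) :
    C.glUnit a b k * C.psibarS i d l - C.psibarS i d l * C.glUnit a b k
      = if k = l then (if d = a then -C.psibarS i b l else 0) else 0 := by
  have hterm : ∀ c : Fin C.m,
      C.psiS ((c : ℕ) + 1) a (-k - C.sig) * C.psibarS ((c : ℕ) + 1) b k * C.psibarS i d l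
        - C.psibarS i d l * (C.psiS ((c : ℕ) + 1) a (-k - C.sig) * C.psibarS ((c : ℕ) + 1) b k)
      = if c = ⟨i - 1, by omega⟩ then
          (if k = l then (if d = a then -C.psibarS i b l else 0) else 0) else 0 := fun c => by
    have hc : 1 ≤ (c : ℕ) + 1 ∧ (c : ℕ) + 1 ≤ C.m := ⟨by omega, c.2⟩
    rw [← mul_assoc (C.psibarS i d l), C.psibarS_mul_psiS hi hc hd ha, mul_assoc,
      (C.commute_psibarS (c + 1) i b d k l).eq, add_mul, mul_assoc, sub_add_cancel_left]
    by_cases h1 : (c : ℕ) + 1 = i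
    · subst h1
      by_cases h2 : k = l
      · subst h2
        have h4 : k + (-k - C.sig) + C.sig = 0 := by omega
        by_cases h3 : d = a <;> simp [h3, h4]
      · have : ¬ l + (-k - C.sig) + C.sig = 0 := by omega
        simp [h2, this]
    · have : ¬ c = ⟨i - 1, by omega⟩ := fun h => h1 (by rw [h]; simp; omega)
      simp [Ne.symm h1, this]
  rw [glUnit, Finset.sum_mul, Finset.mul_sum, ← Finset.sum_sub_distrib]
  simp_rw [hterm]
  simp

theorem emod_toNat_bounds (t : ℤ) : 1 ≤ (t.emod C.m).toNat + 1 ∧ (t.emod C.m).toNat + 1 ≤ C.m := by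
  have h1 : 0 ≤ t.emod C.m := Int.emod_nonneg t (by exact_mod_cast C.hm.ne')
  have h2 : t.emod C.m < C.m := Int.emod_lt_of_pos t (by exact_mod_cast C.hm)
  omega

theorem PhiW_eq_psiS {t : ℤ} (ht : t < 0) :
    ∃ i κ, (1 ≤ i ∧ i ≤ C.m) ∧ κ + C.sig ≤ 0 ∧ ∀ c, C.PhiW c t = C.psiS i c κ := by
  refine ⟨_, _, C.emod_toNat_bounds (-t - 1), ?_, fun _ => rfl⟩
  have hm : (0 : ℤ) < C.m := by exact_mod_cast C.hm
  have hdiv : 0 ≤ (C.m : ℤ) * ((-t - 1) / C.m) :=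
    mul_nonneg hm.le (Int.ediv_nonneg (by omega) hm.le)
  have h : (C.m : ℤ) * ((-t - 1) / C.m) + (-t - 1).emod C.m = -t - 1 :=
    Int.mul_ediv_add_emod _ _
  rw [sub_add_cancel]
  exact Int.ediv_nonpos_of_nonpos_of_neg (by linarith) hm

theorem PhibarW_eq_psibarS {t : ℤ} (ht : t < 0) :
    ∃ i κ, (1 ≤ i ∧ i ≤ C.m) ∧ κ < 0 ∧ ∀ c, C.PhibarW c t = C.psibarS i c κ := by
  refine ⟨_, _, C.emod_toNat_bounds t, ?_, fun _ => rfl⟩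
  have hm : (0 : ℤ) < C.m := by exact_mod_cast C.hm
  have h : 0 ≤ t.emod C.m := Int.emod_nonneg t hm.ne'
  exact Int.ediv_neg_of_neg_of_pos (by omega) hm

/-- Each column of the matrix defining `B_l` consists of `ψ`'s with a fixed subscript and mode,
or of `ψ̄`'s with a fixed subscript and mode. -/
theorem Bentry_column (l : ℕ) (t : Fin l) :
    (∃ i κ, (1 ≤ i ∧ i ≤ C.m) ∧ κ + C.sig ≤ 0 ∧
        ∀ r : Fin l, C.Bentry l r t = C.psiS i ((r : ℕ) + 1) κ) ∨
      ∃ i κ, (1 ≤ i ∧ i ≤ C.m) ∧ κ < 0 ∧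
        ∀ r : Fin l, C.Bentry l r t = C.psibarS i (C.n - (r : ℕ)) κ := by
  unfold Bentry
  split_ifs with ht
  · obtain ⟨i, κ, hi, hκ, h⟩ := C.PhiW_eq_psiS (t := -(((t : ℕ) : ℤ) + 1)) (by omega)
    exact Or.inl ⟨i, κ, hi, hκ, fun r => h _⟩
  · obtain ⟨i, κ, hi, hκ, h⟩ := C.PhibarW_eq_psibarS
      (t := -((((t : ℕ) : ℤ) + 1) - (C.lb1 l : ℤ))) (by omega)
    exact Or.inr ⟨i, κ, hi, hκ, fun r => h _⟩

theorem commute_Bentry {l : ℕ} (hl : l ≤ C.n) (i t j s : Fin l) :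
    Commute (C.Bentry l i t) (C.Bentry l j s) := by
  have hmixed : ∀ {a b c d : ℕ} {k k' : ℤ}, (1 ≤ a ∧ a ≤ C.m) → (1 ≤ b ∧ b ≤ C.m) →
      (1 ≤ c ∧ c ≤ C.n) → (1 ≤ d ∧ d ≤ C.n) → k < 0 → k' + C.sig ≤ 0 →
      Commute (C.psibarS a c k) (C.psiS b d k') := by
    intro a b c d k k' ha hb hc hd hk hk'
    have := C.psibarS_mul_psiS ha hb hc hd k k'
    rwa [if_neg fun h => by omega, add_zero] at this
  rcases C.Bentry_column l t with ⟨a, k, ha, hk, h⟩ | ⟨a, k, ha, hk, h⟩ <;>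
    rcases C.Bentry_column l s with ⟨b, k', hb, hk', h'⟩ | ⟨b, k', hb, hk', h'⟩ <;>
    rw [h, h']
  · exact C.commute_psiS ..
  · exact (hmixed hb ha (by omega) (by omega) hk' hk).symm
  · exact hmixed ha hb (by omega) (by omega) hk hk'
  · exact C.commute_psibarS ..

/-- The matrix `E_{p+1,p} - E_{n+1-p,n-p}`, with `0`-indexed rows and columns. -/
def rowOp (p l : ℕ) (i j : Fin l) : ℤ :=
  (if (j : ℕ) + 1 = i ∧ (i : ℕ) = p then 1 else 0)
    - if (j : ℕ) + 1 = i ∧ (i : ℕ) = C.n - p then 1 else 0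

theorem sum_rowOp_mul {p l : ℕ} (hp : 1 ≤ p) (hp' : p + 1 ≤ C.n) (F : ℕ → C.W) (i : Fin l) :
    ∑ j : Fin l, (C.rowOp p l i j : C.W) * F j
      = (if (i : ℕ) = p then F (p - 1) else 0)
        - if (i : ℕ) = C.n - p then F (C.n - p - 1) else 0 := by
  have hs : ∀ q : ℕ, 1 ≤ q →
      ∑ j : Fin l, (if (j : ℕ) + 1 = i ∧ (i : ℕ) = q then (1 : C.W) else 0) * F j
        = if (i : ℕ) = q then F (q - 1) else 0 := fun q hq => by
    by_cases hi : (i : ℕ) = q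
    · have hi' := i.2
      rw [Finset.sum_eq_single ⟨q - 1, by omega⟩, if_pos ⟨by simp; omega, hi⟩, if_pos hi, one_mul]
      · intro j _ hj
        rw [if_neg, zero_mul]
        exact fun h => hj (Fin.ext (by simp; omega))
      · simp
    · simp [hi]
  rw [← hs p hp, ← hs (C.n - p) (by omega), ← Finset.sum_sub_distrib]
  refine Finset.sum_congr rfl fun j _ => ?_
  rw [rowOp, ← sub_mul]
  push_cast
  rfl

theorem glUnit_sub_commutator_Bentry {p l : ℕ} (hp : 1 ≤ p) (hp' : p + 1 ≤ C.n) (hl : l ≤ C.n)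
    (t : Fin l) : ∃ κ : ℤ, ∀ k i,
      (C.glUnit p (p + 1) k - C.glUnit (C.n - p) (C.n + 1 - p) k) * C.Bentry l i t
        - C.Bentry l i t * (C.glUnit p (p + 1) k - C.glUnit (C.n - p) (C.n + 1 - p) k)
      = if k = κ then ∑ j, (C.rowOp p l i j : C.W) * C.Bentry l j t else 0 := by
  have hsplit : ∀ x y z : C.W, (x - y) * z - z * (x - y) = (x * z - z * x) - (y * z - z * y) :=
    fun x y z => by noncomm_ring
  rcases C.Bentry_column l t with ⟨a, κ, ha, -, h⟩ | ⟨a, κ, ha, -, h⟩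
  · refine ⟨-κ - C.sig, fun k i => ?_⟩
    simp_rw [h, hsplit]
    rw [C.sum_rowOp_mul hp hp' (fun j => C.psiS a (j + 1) κ),
      C.glUnit_commutator_psiS (by omega) ha (by omega),
      C.glUnit_commutator_psiS (by omega) ha (by omega)]
    have e1 : (i : ℕ) + 1 = p + 1 ↔ (i : ℕ) = p := by omega
    have e2 : (i : ℕ) + 1 = C.n + 1 - p ↔ (i : ℕ) = C.n - p := by omega
    have e3 : p - 1 + 1 = p := by omega
    have e4 : C.n - p - 1 + 1 = C.n - p := by omega
    by_cases hk : k = -κ - C.sig <;> simp only [hk, e1, e2, e3, e4, if_true, if_false, sub_zero]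
  · refine ⟨κ, fun k i => ?_⟩
    simp_rw [h, hsplit]
    rw [C.sum_rowOp_mul hp hp' (fun j => C.psibarS a (C.n - j) κ),
      C.glUnit_commutator_psibarS (by omega) ha (by omega),
      C.glUnit_commutator_psibarS (by omega) ha (by omega)]
    have e1 : C.n - (i : ℕ) = p ↔ (i : ℕ) = C.n - p := by omega
    have e2 : C.n - (i : ℕ) = C.n - p ↔ (i : ℕ) = p := by omega
    have e3 : C.n - (p - 1) = C.n + 1 - p := by omega
    have e4 : C.n - (C.n - p - 1) = p + 1 := by omega
    by_cases hk : k = κ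
    · simp only [hk, e1, e2, e3, e4, if_true]
      split_ifs <;> abel
    · simp only [hk, if_false, sub_zero]

end WCtx

open WCtx in
/-- **Lemma 5.16.**  For `1 ≤ p ≤ n-1` and `1 ≤ l ≤ n`, all but finitely many of the
commutators `[Σ_c (:ψ_c^p(-r)ψ̄_c^{p+1}(r): − :ψ_c^{n-p}(-r)ψ̄_c^{n+1-p}(r):), B_l]`
(`r ∈ S`) vanish, and their (finite) sum over `r ∈ S` is zero. -/
theorem statement17 (C : WCtx) (p : ℕ) (hp : 1 ≤ p) (hp' : p + 1 ≤ C.n)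
    (l : ℕ) (hl : 1 ≤ l) (hl' : l ≤ C.n) :
    {k : ℤ |
      (∑ c : Fin C.m,
          (C.nord (C.psiS ((c : ℕ) + 1) p (-k - C.sig)) k (C.psibarS ((c : ℕ) + 1) (p + 1) k)
            - C.nord (C.psiS ((c : ℕ) + 1) (C.n - p) (-k - C.sig)) k
                (C.psibarS ((c : ℕ) + 1) (C.n + 1 - p) k))) * C.Bdet l
        - C.Bdet l *
          (∑ c : Fin C.m,
            (C.nord (C.psiS ((c : ℕ) + 1) p (-k - C.sig)) k (C.psibarS ((c : ℕ) + 1) (p + 1) k)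
              - C.nord (C.psiS ((c : ℕ) + 1) (C.n - p) (-k - C.sig)) k
                  (C.psibarS ((c : ℕ) + 1) (C.n + 1 - p) k))) ≠ 0}.Finite
    ∧
    (∑ᶠ k : ℤ,
      ((∑ c : Fin C.m,
          (C.nord (C.psiS ((c : ℕ) + 1) p (-k - C.sig)) k (C.psibarS ((c : ℕ) + 1) (p + 1) k)
            - C.nord (C.psiS ((c : ℕ) + 1) (C.n - p) (-k - C.sig)) k
                (C.psibarS ((c : ℕ) + 1) (C.n + 1 - p) k))) * C.Bdet l
        - C.Bdet l *
          (∑ c : Fin C.m,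
            (C.nord (C.psiS ((c : ℕ) + 1) p (-k - C.sig)) k (C.psibarS ((c : ℕ) + 1) (p + 1) k)
              - C.nord (C.psiS ((c : ℕ) + 1) (C.n - p) (-k - C.sig)) k
                  (C.psibarS ((c : ℕ) + 1) (C.n + 1 - p) k))))) = 0 := by
  have hX : ∀ k : ℤ,
      (∑ c : Fin C.m,
        (C.nord (C.psiS ((c : ℕ) + 1) p (-k - C.sig)) k (C.psibarS ((c : ℕ) + 1) (p + 1) k)
          - C.nord (C.psiS ((c : ℕ) + 1) (C.n - p) (-k - C.sig)) k
              (C.psibarS ((c : ℕ) + 1) (C.n + 1 - p) k)))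
        = C.glUnit p (p + 1) k - C.glUnit (C.n - p) (C.n + 1 - p) k := fun k => by
    rw [glUnit, glUnit, ← Finset.sum_sub_distrib]
    refine Finset.sum_congr rfl fun c _ => ?_
    rw [C.nord_psiS_psibarS (by omega) (by omega) (by omega),
      C.nord_psiS_psibarS (by omega) (by omega) (by omega)]
  simp_rw [hX]
  choose κ hκ using C.glUnit_sub_commutator_Bentry hp hp' hl'
  exact C.finite_and_finsum_commutator_ncdet _ (C.commute_Bentry hl') (C.rowOp p l)
    (fun i => by simp [rowOp]) _ κ fun k i t => hκ t k i
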